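/- arXiv:2001.03447 — 6 statements merged into one kernel-verified Lean document; each statement's English description precedes it below -/
import Mathlib

section
/- For every coordinate k ∈ {1,…,d}, the expected weighted binary feature satisfies E[π(X) · z_k(X)] = C_d · α_k. -/
open Real MeasureTheory ProbabilityTheory

/-- Completing the square: a Gaussian weight of variance `ν ^ 2` centred at `a` times the density
of `N(m, σ ^ 2)` is a multiple of a Gaussian density. -/
lemma exp_mul_gaussianPDFReal {σ ν : ℝ} {v w : NNReal} (hσ : 0 < σ) (hν : 0 < ν)
    (hv : (v : ℝ) = σ ^ 2) (hw : (w : ℝ) = (ν * σ / √(ν ^ 2 + σ ^ 2)) ^ 2) (a m x : ℝ) :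
    exp (-(x - a) ^ 2 / (2 * ν ^ 2)) * gaussianPDFReal m v x =
      √(ν ^ 2 / (ν ^ 2 + σ ^ 2)) * exp (-(a - m) ^ 2 / (2 * (ν ^ 2 + σ ^ 2))) *
        gaussianPDFReal ((ν ^ 2 * m + σ ^ 2 * a) / (ν ^ 2 + σ ^ 2)) w x := by
  have hs : 0 < ν ^ 2 + σ ^ 2 := by positivity
  have hsq : √(ν ^ 2 + σ ^ 2) ^ 2 = ν ^ 2 + σ ^ 2 := sq_sqrt hs.le
  simp only [gaussianPDFReal, hv, hw]
  have hexp : exp (-(x - a) ^ 2 / (2 * ν ^ 2)) * exp (-(x - m) ^ 2 / (2 * σ ^ 2)) =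
      exp (-(a - m) ^ 2 / (2 * (ν ^ 2 + σ ^ 2))) *
        exp (-(x - (ν ^ 2 * m + σ ^ 2 * a) / (ν ^ 2 + σ ^ 2)) ^ 2 /
          (2 * (ν * σ / √(ν ^ 2 + σ ^ 2)) ^ 2)) := by
    rw [← exp_add, ← exp_add, div_pow, hsq]
    congr 1
    field_simp
    ring
  have hconst : (√(2 * π * σ ^ 2))⁻¹ = √(ν ^ 2 / (ν ^ 2 + σ ^ 2)) *
      (√(2 * π * (ν * σ / √(ν ^ 2 + σ ^ 2)) ^ 2))⁻¹ := by
    rw [sqrt_mul (by positivity) (σ ^ 2), sqrt_sq hσ.le, sqrt_mul (by positivity) (_ ^ 2),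
      sqrt_sq (by positivity), sqrt_div (by positivity), sqrt_sq hν.le]
    field_simp
  rw [mul_left_comm, hexp, hconst]
  ring

/-- Integrating against a Gaussian weight under `N(m, σ ^ 2)` amounts to integrating against
another Gaussian distribution, up to a constant factor. -/
lemma integral_exp_mul_gaussianReal {σ ν : ℝ} {v w : NNReal} (hσ : 0 < σ) (hν : 0 < ν)
    (hv : (v : ℝ) = σ ^ 2) (hw : (w : ℝ) = (ν * σ / √(ν ^ 2 + σ ^ 2)) ^ 2) (a m : ℝ) (f : ℝ → ℝ) :
    ∫ x, exp (-(x - a) ^ 2 / (2 * ν ^ 2)) * f x ∂(gaussianReal m v) =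
      √(ν ^ 2 / (ν ^ 2 + σ ^ 2)) * exp (-(a - m) ^ 2 / (2 * (ν ^ 2 + σ ^ 2))) *
        ∫ x, f x ∂(gaussianReal ((ν ^ 2 * m + σ ^ 2 * a) / (ν ^ 2 + σ ^ 2)) w) := by
  rw [integral_gaussianReal_eq_integral_smul (by rw [← NNReal.coe_ne_zero, hv]; positivity),
    integral_gaussianReal_eq_integral_smul
      (by rw [← NNReal.coe_ne_zero, hw]; positivity),
    ← integral_const_mul]
  congr 1 with x
  simp only [smul_eq_mul]
  rw [← mul_assoc, ← mul_assoc, ← exp_mul_gaussianPDFReal hσ hν hv hw, mul_comm (gaussianPDFReal _ _ _)]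

/-- The probability of `[a, b)` under `N(m, s ^ 2)` as an interval integral. -/
lemma integral_ite_gaussianReal {s : ℝ} {v : NNReal} (hs : 0 < s) (hv : (v : ℝ) = s ^ 2) (m : ℝ) {a b : ℝ}
    (hab : a ≤ b) :
    ∫ x, (if a ≤ x ∧ x < b then (1 : ℝ) else 0) ∂(gaussianReal m v) =
      ∫ t in a..b, exp (-(t - m) ^ 2 / (2 * s ^ 2)) / (s * √(2 * π)) := by
  rw [integral_gaussianReal_eq_integral_smul
      (by rw [← NNReal.coe_ne_zero, hv]; positivity),
    intervalIntegral.integral_of_le hab, ← integral_Ico_eq_integral_Ioc,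
    ← integral_indicator measurableSet_Ico]
  congr 1 with x
  simp only [Set.indicator_apply, Set.mem_Ico, smul_eq_mul, mul_ite, mul_one, mul_zero]
  congr 1
  simp only [gaussianPDFReal, hv]
  rw [sqrt_mul (by positivity) (s ^ 2), sqrt_sq hs.le, mul_comm s, inv_mul_eq_div]

/-- Expected weighted binary feature: `E[π(X) z_k(X)] = C_d α_k`. -/
theorem expected_weight_feature (d : ℕ) (hd : 1 ≤ d) (ξ μ : Fin d → ℝ) (σ ν : ℝ)
    (hσ : 0 < σ) (hν : 0 < ν)
    (qm qp : Fin d → ℝ) (hq : ∀ j, qm j < qp j) (hqξ : ∀ j, qm j ≤ ξ j ∧ ξ j < qp j)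
    (μt : Fin d → ℝ) (hμt : ∀ j, μt j = (ν ^ 2 * μ j + σ ^ 2 * ξ j) / (ν ^ 2 + σ ^ 2))
    (σt : ℝ) (hσt : σt = ν * σ / Real.sqrt (ν ^ 2 + σ ^ 2))
    (Cd : ℝ)
    (hCd : Cd = (ν ^ 2 / (ν ^ 2 + σ ^ 2)) ^ ((d : ℝ) / 2) *
        Real.exp (-(∑ j, (ξ j - μ j) ^ 2) / (2 * (ν ^ 2 + σ ^ 2))))
    (α : Fin d → ℝ)
    (hα : ∀ j, α j = ∫ t in (qm j)..(qp j),
        Real.exp (-(t - μt j) ^ 2 / (2 * σt ^ 2)) / (σt * Real.sqrt (2 * Real.pi)))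
    (P : Measure (Fin d → ℝ))
    (hP : P = Measure.pi fun j => gaussianReal (μ j) ⟨σ ^ 2, sq_nonneg σ⟩)
    (k : Fin d) :
    ∫ x, Real.exp (-(∑ j, (x j - ξ j) ^ 2) / (2 * ν ^ 2)) *
        (if qm k ≤ x k ∧ x k < qp k then (1 : ℝ) else 0) ∂P
      = Cd * α k := by
  obtain ⟨v, hv, hP⟩ : ∃ v : NNReal, (v : ℝ) = σ ^ 2 ∧
      P = Measure.pi fun j => gaussianReal (μ j) v := ⟨_, rfl, hP⟩
  obtain ⟨w, hw⟩ : ∃ w : NNReal, (w : ℝ) = (ν * σ / √(ν ^ 2 + σ ^ 2)) ^ 2 :=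
    ⟨⟨_, sq_nonneg _⟩, rfl⟩
  have hs : 0 < σt := by rw [hσt]; positivity
  have hsplit : ∀ x : Fin d → ℝ, exp (-(∑ j, (x j - ξ j) ^ 2) / (2 * ν ^ 2)) *
      (if qm k ≤ x k ∧ x k < qp k then (1 : ℝ) else 0) =
      ∏ j, (exp (-(x j - ξ j) ^ 2 / (2 * ν ^ 2)) *
        (if j = k then (if qm k ≤ x j ∧ x j < qp k then (1 : ℝ) else 0) else 1)) := by
    intro x
    rw [Finset.prod_mul_distrib, Finset.prod_ite_eq' Finset.univ k, ← exp_sum,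
      ← Finset.sum_div, Finset.sum_neg_distrib, if_pos (Finset.mem_univ k)]
  have hfactor : ∀ j, ∫ x, exp (-(x - ξ j) ^ 2 / (2 * ν ^ 2)) *
      (if j = k then (if qm k ≤ x ∧ x < qp k then (1 : ℝ) else 0) else 1)
        ∂(gaussianReal (μ j) v) =
      √(ν ^ 2 / (ν ^ 2 + σ ^ 2)) * exp (-(ξ j - μ j) ^ 2 / (2 * (ν ^ 2 + σ ^ 2))) *
        (if j = k then α j else 1) := by
    intro j
    rw [integral_exp_mul_gaussianReal hσ hν hv hw]
    congr 1
    split_ifs with hj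
    · subst hj hσt
      rw [integral_ite_gaussianReal hs hw _ (hq j).le, hα, hμt]
    · simp
  subst hP
  simp_rw [hsplit]
  rw [integral_fintype_prod_eq_prod (𝕜 := ℝ) (fun j y => exp (-(y - ξ j) ^ 2 / (2 * ν ^ 2)) *
    (if j = k then (if qm k ≤ y ∧ y < qp k then (1 : ℝ) else 0) else 1))]
  simp_rw [hfactor]
  rw [Finset.prod_mul_distrib, Finset.prod_mul_distrib, Finset.prod_ite_eq' Finset.univ k,
    if_pos (Finset.mem_univ k), ← exp_sum, ← Finset.sum_div, Finset.sum_neg_distrib,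
    Finset.prod_const, Finset.card_univ, Fintype.card_fin, hCd, sqrt_eq_rpow,
    ← rpow_mul_natCast (by positivity), one_div_mul_eq_div]
end

section
/- If f(x) = aᵀx + b is a linear model, then the expected weighted response satisfies E[π(X) · f(X)] = C_d · f(μ̃), where μ̃ = (ν²μ + σ²ξ)/(ν²+σ²). -/
open Real MeasureTheory ProbabilityTheory
open scoped NNReal

/-- The product of a Gaussian density with a Gaussian weight is a multiple of the density with
precision-weighted mean. -/
lemma gaussianPDFReal_mul_exp_neg_sq (m ξ : ℝ) {v τ : ℝ≥0} (hv : v ≠ 0) (hτ : τ ≠ 0) (x : ℝ) :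
    gaussianPDFReal m v x * exp (-(x - ξ) ^ 2 / (2 * τ)) =
      √(τ / (τ + v)) * exp (-(ξ - m) ^ 2 / (2 * (τ + v))) *
        gaussianPDFReal ((τ * m + v * ξ) / (τ + v)) (v * (τ / (τ + v))) x := by
  have hv' : (0 : ℝ) < v := by positivity
  have hτ' : (0 : ℝ) < τ := by positivity
  have hr : 0 < √((τ : ℝ) / (τ + v)) := by positivity
  have hsqrt : √(2 * π * (v * (τ / (τ + v)))) = √(2 * π * v) * √(τ / (τ + v)) := by
    rw [← mul_assoc, sqrt_mul (by positivity)]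
  have hexp : -(x - m) ^ 2 / (2 * v) + -(x - ξ) ^ 2 / (2 * τ) =
      -(ξ - m) ^ 2 / (2 * (τ + v)) +
        -(x - (τ * m + v * ξ) / (τ + v)) ^ 2 / (2 * (v * (τ / (τ + v)))) := by
    have : (τ + v : ℝ) ≠ 0 := by positivity
    field_simp
    ring
  simp only [gaussianPDFReal, NNReal.coe_mul, NNReal.coe_div, NNReal.coe_add]
  rw [mul_assoc, ← exp_add, hexp, exp_add, hsqrt, mul_inv]
  field_simp

/-- Weighting a Gaussian by a Gaussian kernel amounts to integrating against a rescaled Gaussian. -/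
lemma integral_exp_neg_sq_mul_gaussianReal (m ξ : ℝ) {v τ : ℝ≥0} (hv : v ≠ 0) (hτ : τ ≠ 0)
    (g : ℝ → ℝ) :
    ∫ x, exp (-(x - ξ) ^ 2 / (2 * τ)) * g x ∂gaussianReal m v =
      √(τ / (τ + v)) * exp (-(ξ - m) ^ 2 / (2 * (τ + v))) *
        ∫ x, g x ∂gaussianReal ((τ * m + v * ξ) / (τ + v)) (v * (τ / (τ + v))) := by
  have hw : v * (τ / (τ + v)) ≠ 0 := by positivity
  rw [integral_gaussianReal_eq_integral_smul hv, integral_gaussianReal_eq_integral_smul hw,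
    ← integral_const_mul]
  refine integral_congr_ae (.of_forall fun x ↦ ?_)
  simp only [smul_eq_mul]
  rw [← mul_assoc, gaussianPDFReal_mul_exp_neg_sq m ξ hv hτ x, mul_assoc]

/-- Gaussian-weighted integrals of product functions against a product of Gaussians. -/
lemma integral_exp_neg_sum_sq_mul_prod_gaussianReal {ι : Type*} [Fintype ι] (m ξ : ι → ℝ)
    {v τ : ℝ≥0} (hv : v ≠ 0) (hτ : τ ≠ 0) (g : ι → ℝ → ℝ) :
    ∫ x : ι → ℝ, exp (-(∑ i, (x i - ξ i) ^ 2) / (2 * τ)) * ∏ i, g i (x i)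
        ∂(Measure.pi fun i ↦ gaussianReal (m i) v) =
      (τ / (τ + v) : ℝ) ^ ((Fintype.card ι : ℝ) / 2) *
        exp (-(∑ i, (ξ i - m i) ^ 2) / (2 * (τ + v))) *
        ∏ i, ∫ x, g i x ∂gaussianReal ((τ * m i + v * ξ i) / (τ + v)) (v * (τ / (τ + v))) := by
  have hexp (u : ι → ℝ) (c : ℝ) : exp (-(∑ i, u i) / c) = ∏ i, exp (-u i / c) := by
    rw [← exp_sum, ← Finset.sum_div, Finset.sum_neg_distrib]
  have hpow : (τ / (τ + v) : ℝ) ^ ((Fintype.card ι : ℝ) / 2) = ∏ _i : ι, √(τ / (τ + v)) := by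
    rw [Finset.prod_const, Finset.card_univ, rpow_div_two_eq_sqrt _ (by positivity), rpow_natCast]
  simp only [hexp, hpow, ← Finset.prod_mul_distrib]
  rw [integral_fintype_prod_eq_prod
    (f := fun i y ↦ exp (-(y - ξ i) ^ 2 / (2 * τ)) * g i y)]
  exact Finset.prod_congr rfl fun i _ ↦
    integral_exp_neg_sq_mul_gaussianReal (m i) (ξ i) hv hτ (g i)

/-- Expected weighted response for a linear model: `E[π(X) f(X)] = C_d f(μ̃)`. -/
theorem expected_weight_response (d : ℕ) (hd : 1 ≤ d) (ξ μ : Fin d → ℝ) (σ ν : ℝ)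
    (hσ : 0 < σ) (hν : 0 < ν) (a : Fin d → ℝ) (b : ℝ)
    (f : (Fin d → ℝ) → ℝ) (hf : ∀ x, f x = (∑ j, a j * x j) + b)
    (μt : Fin d → ℝ) (hμt : ∀ j, μt j = (ν ^ 2 * μ j + σ ^ 2 * ξ j) / (ν ^ 2 + σ ^ 2))
    (Cd : ℝ)
    (hCd : Cd = (ν ^ 2 / (ν ^ 2 + σ ^ 2)) ^ ((d : ℝ) / 2) *
        Real.exp (-(∑ j, (ξ j - μ j) ^ 2) / (2 * (ν ^ 2 + σ ^ 2))))
    (P : Measure (Fin d → ℝ))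
    (hP : P = Measure.pi fun j => gaussianReal (μ j) ⟨σ ^ 2, sq_nonneg σ⟩) :
    ∫ x, Real.exp (-(∑ j, (x j - ξ j) ^ 2) / (2 * ν ^ 2)) * f x ∂P
      = Cd * f μt := by
  obtain ⟨v, hv⟩ : ∃ v : ℝ≥0, v = ⟨σ ^ 2, sq_nonneg σ⟩ := ⟨_, rfl⟩
  obtain ⟨τ, hτ⟩ : ∃ τ : ℝ≥0, (τ : ℝ) = ν ^ 2 := ⟨⟨ν ^ 2, sq_nonneg ν⟩, rfl⟩
  have hvσ : (v : ℝ) = σ ^ 2 := congrArg NNReal.toReal hv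
  have hv0 : v ≠ 0 := by rw [← NNReal.coe_ne_zero, hvσ]; positivity
  have hτ0 : τ ≠ 0 := by rw [← NNReal.coe_ne_zero, hτ]; positivity
  rw [← hv] at hP
  rw [← hτ, ← hvσ] at hCd
  simp only [← hτ, ← hvσ] at hμt ⊢
  subst hCd hP
  set P := Measure.pi fun j => gaussianReal (μ j) v
  set w : (Fin d → ℝ) → ℝ := fun x ↦ exp (-(∑ j, (x j - ξ j) ^ 2) / (2 * τ))
  set c := (τ / (τ + v) : ℝ) ^ ((d : ℝ) / 2) *
    exp (-(∑ j, (ξ j - μ j) ^ 2) / (2 * (τ + v)))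
  have hmass : ∫ x, w x ∂P = c := by
    simpa using integral_exp_neg_sum_sq_mul_prod_gaussianReal μ ξ hv0 hτ0 fun _ _ ↦ 1
  have hcoord (j : Fin d) : ∫ x, w x * x j ∂P = c * μt j := by
    have h := integral_exp_neg_sum_sq_mul_prod_gaussianReal μ ξ hv0 hτ0
      fun i y ↦ if i = j then y else 1
    have hint (i : Fin d) (v : NNReal) (m : ℝ) :
        ∫ y, (if i = j then y else 1) ∂gaussianReal m v = if i = j then m else 1 := by
      split_ifs <;> simp
    simpa [hint, ← hμt] using h
  have hbound (g : (Fin d → ℝ) → ℝ) (hg : Integrable g P) : Integrable (fun x ↦ w x * g x) P := by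
    refine hg.bdd_mul (c := 1) (by fun_prop) (.of_forall fun x ↦ ?_)
    rw [norm_of_nonneg (exp_nonneg _), exp_le_one_iff, neg_div, neg_nonpos]
    positivity
  have hid (j : Fin d) : Integrable (fun x : Fin d → ℝ ↦ x j) P :=
    integrable_comp_eval (μ := fun j ↦ gaussianReal (μ j) v) (i := j) (f := fun y : ℝ ↦ y)
      ((memLp_id_gaussianReal 1).integrable le_rfl)
  have hsplit (x : Fin d → ℝ) : w x * f x = ∑ j, a j * (w x * x j) + b * w x := by
    rw [hf, mul_add, Finset.mul_sum, mul_comm b]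
    congr 1
    exact Finset.sum_congr rfl fun j _ ↦ by ring
  have hterm (j : Fin d) : Integrable (fun x ↦ a j * (w x * x j)) P :=
    (hbound _ (hid j)).const_mul _
  have hw : Integrable w P := by simpa using hbound (fun _ ↦ 1) (integrable_const 1)
  change ∫ x, w x * f x ∂P = c * f μt
  simp only [hsplit]
  rw [integral_add (integrable_finsetSum _ fun j _ ↦ hterm j) (hw.const_mul b),
    integral_finsetSum _ fun j _ ↦ hterm j, integral_const_mul, hmass, hf, mul_add,
    Finset.mul_sum, mul_comm b]
  congr 1
  refine Finset.sum_congr rfl fun j _ ↦ ?_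
  rw [integral_const_mul, hcoord]
  ring
end

section
/- If f(x) = aᵀx + b is a linear model, then for every coordinate j ∈ {1,…,d} the expected weighted feature–response product satisfies E[π(X) · z_j(X) · f(X)] = C_d · (α_j · f(μ̃) − a_j · θ_j). -/
open Real MeasureTheory ProbabilityTheory

/-- Multiplying a Gaussian density by a Gaussian kernel gives a multiple of a Gaussian density. -/
lemma gaussianKernel_mul_gaussianPDFReal {σ ν : ℝ} {v w : NNReal} (hσ : 0 < σ) (hν : 0 < ν)
    (hv : (v : ℝ) = σ ^ 2)
    (hw : (w : ℝ) = ν ^ 2 * σ ^ 2 / (ν ^ 2 + σ ^ 2)) (ξ μ x : ℝ) :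
    Real.exp (-(x - ξ) ^ 2 / (2 * ν ^ 2)) * gaussianPDFReal μ v x =
      √(ν ^ 2 / (ν ^ 2 + σ ^ 2)) * Real.exp (-(ξ - μ) ^ 2 / (2 * (ν ^ 2 + σ ^ 2))) *
        gaussianPDFReal ((ν ^ 2 * μ + σ ^ 2 * ξ) / (ν ^ 2 + σ ^ 2)) w x := by
  rw [gaussianPDFReal, gaussianPDFReal, hv]
  have hconst : (√(2 * π * σ ^ 2))⁻¹ =
      √(ν ^ 2 / (ν ^ 2 + σ ^ 2)) * (√(2 * π * w))⁻¹ := by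
    rw [← Real.sqrt_inv, ← Real.sqrt_inv, ← Real.sqrt_mul (by positivity), hw]
    congr 1
    field_simp
  have hexp : Real.exp (-(x - ξ) ^ 2 / (2 * ν ^ 2)) * Real.exp (-(x - μ) ^ 2 / (2 * σ ^ 2)) =
      Real.exp (-(ξ - μ) ^ 2 / (2 * (ν ^ 2 + σ ^ 2))) *
        Real.exp (-(x - (ν ^ 2 * μ + σ ^ 2 * ξ) / (ν ^ 2 + σ ^ 2)) ^ 2 / (2 * w)) := by
    rw [← Real.exp_add, ← Real.exp_add, hw]
    congr 1
    field_simp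
    ring
  rw [hconst]
  linear_combination √(ν ^ 2 / (ν ^ 2 + σ ^ 2)) * (√(2 * π * w))⁻¹ * hexp

lemma integral_gaussianKernel_mul_gaussianReal {σ ν : ℝ} {v w : NNReal} (hσ : 0 < σ) (hν : 0 < ν)
    (hv : (v : ℝ) = σ ^ 2)
    (hw : (w : ℝ) = ν ^ 2 * σ ^ 2 / (ν ^ 2 + σ ^ 2)) (ξ μ : ℝ) (g : ℝ → ℝ) :
    ∫ x, Real.exp (-(x - ξ) ^ 2 / (2 * ν ^ 2)) * g x ∂gaussianReal μ v =
      √(ν ^ 2 / (ν ^ 2 + σ ^ 2)) * Real.exp (-(ξ - μ) ^ 2 / (2 * (ν ^ 2 + σ ^ 2))) *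
        ∫ x, g x ∂gaussianReal ((ν ^ 2 * μ + σ ^ 2 * ξ) / (ν ^ 2 + σ ^ 2)) w := by
  have hv0 : v ≠ 0 := NNReal.coe_ne_zero.1 (by rw [hv]; positivity)
  have hw0 : w ≠ 0 := NNReal.coe_ne_zero.1 (by rw [hw]; positivity)
  rw [integral_gaussianReal_eq_integral_smul hv0, integral_gaussianReal_eq_integral_smul hw0,
    ← integral_const_mul]
  congr 1 with x
  simp only [smul_eq_mul]
  linear_combination g x * gaussianKernel_mul_gaussianPDFReal hσ hν hv hw ξ μ x

/-- The expectation of a product of one-coordinate functions, weighted by a Gaussian kernel,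
under a product Gaussian measure. -/
lemma integral_gaussianKernel_mul_prod_pi_gaussianReal {d : ℕ} {σ ν : ℝ} {v w : NNReal}
    (hσ : 0 < σ) (hν : 0 < ν) (hv : (v : ℝ) = σ ^ 2)
    (hw : (w : ℝ) = ν ^ 2 * σ ^ 2 / (ν ^ 2 + σ ^ 2)) (ξ μ : Fin d → ℝ)
    (g : Fin d → ℝ → ℝ) :
    (∫ x : Fin d → ℝ, Real.exp (-(∑ i, (x i - ξ i) ^ 2) / (2 * ν ^ 2)) * ∏ k, g k (x k)
        ∂Measure.pi fun j => gaussianReal (μ j) v) =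
      (ν ^ 2 / (ν ^ 2 + σ ^ 2)) ^ ((d : ℝ) / 2) *
        Real.exp (-(∑ j, (ξ j - μ j) ^ 2) / (2 * (ν ^ 2 + σ ^ 2))) *
        ∏ k, ∫ x, g k x ∂gaussianReal ((ν ^ 2 * μ k + σ ^ 2 * ξ k) / (ν ^ 2 + σ ^ 2)) w := by
  have hexp (u : Fin d → ℝ) (c : ℝ) :
      Real.exp (-(∑ i, u i ^ 2) / c) = ∏ i, Real.exp (-u i ^ 2 / c) := by
    rw [← Real.exp_sum, ← Finset.sum_div, Finset.sum_neg_distrib]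
  have hpow : (ν ^ 2 / (ν ^ 2 + σ ^ 2)) ^ ((d : ℝ) / 2) =
      ∏ _k : Fin d, √(ν ^ 2 / (ν ^ 2 + σ ^ 2)) := by
    rw [Finset.prod_const, Finset.card_univ, Fintype.card_fin, Real.sqrt_eq_rpow,
      ← Real.rpow_mul_natCast (by positivity)]
    congr 1
    ring
  simp only [hexp, hpow, ← Finset.prod_mul_distrib]
  rw [integral_fintype_prod_eq_prod
    (f := fun k t => Real.exp (-(t - ξ k) ^ 2 / (2 * ν ^ 2)) * g k t)]
  exact Finset.prod_congr rfl fun k _ =>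
    integral_gaussianKernel_mul_gaussianReal hσ hν hv hw (ξ k) (μ k) (g k)

lemma integrable_gaussianKernel_mul_prod_pi {d : ℕ} (ν : ℝ) (ξ : Fin d → ℝ)
    {γ : Fin d → Measure ℝ} [∀ k, SigmaFinite (γ k)] {g : Fin d → ℝ → ℝ}
    (hg : ∀ k, Integrable (g k) (γ k)) :
    Integrable (fun x : Fin d → ℝ =>
      Real.exp (-(∑ i, (x i - ξ i) ^ 2) / (2 * ν ^ 2)) * ∏ k, g k (x k)) (Measure.pi γ) := by
  refine (Integrable.fintype_prod hg).bdd_mul (c := 1)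
    (Continuous.aestronglyMeasurable (by fun_prop)) (.of_forall fun x => ?_)
  rw [Real.norm_of_nonneg (Real.exp_pos _).le, Real.exp_le_one_iff]
  exact div_nonpos_of_nonpos_of_nonneg
    (neg_nonpos.2 (Finset.sum_nonneg fun i _ => sq_nonneg _)) (by positivity)

lemma integral_Ico_ite_mul_gaussianReal {s p q : ℝ} {w : NNReal} (hs : 0 < s)
    (hw : (w : ℝ) = s ^ 2) (hpq : p ≤ q) (m : ℝ) (g : ℝ → ℝ) :
    ∫ x, (if p ≤ x ∧ x < q then (1 : ℝ) else 0) * g x ∂gaussianReal m w =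
      ∫ t in p..q, Real.exp (-(t - m) ^ 2 / (2 * s ^ 2)) / (s * √(2 * π)) * g t := by
  have hw0 : w ≠ 0 := NNReal.coe_ne_zero.1 (by rw [hw]; positivity)
  rw [integral_gaussianReal_eq_integral_smul hw0, intervalIntegral.integral_of_le hpq,
    ← integral_Ico_eq_integral_Ioc, ← integral_indicator measurableSet_Ico]
  congr 1 with x
  have hsqrt : √(2 * π * s ^ 2) = s * √(2 * π) := by
    rw [Real.sqrt_mul (by positivity), Real.sqrt_sq hs.le, mul_comm]
  simp only [Set.indicator_apply, Set.mem_Ico, gaussianPDFReal, hw, smul_eq_mul, hsqrt]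
  split_ifs
  · ring
  · ring

/-- The first moment of a Gaussian density over an interval. -/
lemma integral_gaussian_mul_id {s : ℝ} (hs : 0 < s) (p q m : ℝ) :
    ∫ t in p..q, Real.exp (-(t - m) ^ 2 / (2 * s ^ 2)) / (s * √(2 * π)) * t =
      (∫ t in p..q, Real.exp (-(t - m) ^ 2 / (2 * s ^ 2)) / (s * √(2 * π))) * m -
        s / √(2 * π) * (Real.exp (-(q - m) ^ 2 / (2 * s ^ 2)) -
          Real.exp (-(p - m) ^ 2 / (2 * s ^ 2))) := by
  have hderiv (t : ℝ) : HasDerivAt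
      (fun t => -(s / √(2 * π)) * Real.exp (-(t - m) ^ 2 / (2 * s ^ 2)))
      (Real.exp (-(t - m) ^ 2 / (2 * s ^ 2)) / (s * √(2 * π)) * (t - m)) t := by
    refine ((((((hasDerivAt_id' t).sub_const m).fun_pow 2).fun_neg).div_const
      (2 * s ^ 2)).exp.const_mul (-(s / √(2 * π)))).congr_deriv ?_
    field_simp
    simp
  have hcont : Continuous fun t => Real.exp (-(t - m) ^ 2 / (2 * s ^ 2)) / (s * √(2 * π)) := by
    fun_prop
  have hint := intervalIntegral.integral_eq_sub_of_hasDerivAt (a := p) (b := q)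
    (fun t _ => hderiv t) ((hcont.mul (by fun_prop)).intervalIntegrable _ _)
  simp only [mul_sub] at hint
  rw [intervalIntegral.integral_sub (Continuous.intervalIntegrable (by fun_prop) _ _)
    (Continuous.intervalIntegrable (by fun_prop) _ _),
    intervalIntegral.integral_mul_const] at hint
  linear_combination hint

/-- Expected weighted feature–response product for a linear model:
`E[π(X) z_j(X) f(X)] = C_d (α_j f(μ̃) − a_j θ_j)`. -/
theorem expected_weight_feature_response (d : ℕ) (hd : 1 ≤ d) (ξ μ : Fin d → ℝ) (σ ν : ℝ)
    (hσ : 0 < σ) (hν : 0 < ν) (a : Fin d → ℝ) (b : ℝ)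
    (f : (Fin d → ℝ) → ℝ) (hf : ∀ x, f x = (∑ j, a j * x j) + b)
    (qm qp : Fin d → ℝ) (hq : ∀ j, qm j < qp j) (hqξ : ∀ j, qm j ≤ ξ j ∧ ξ j < qp j)
    (μt : Fin d → ℝ) (hμt : ∀ j, μt j = (ν ^ 2 * μ j + σ ^ 2 * ξ j) / (ν ^ 2 + σ ^ 2))
    (σt : ℝ) (hσt : σt = ν * σ / Real.sqrt (ν ^ 2 + σ ^ 2))
    (Cd : ℝ)
    (hCd : Cd = (ν ^ 2 / (ν ^ 2 + σ ^ 2)) ^ ((d : ℝ) / 2) *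
        Real.exp (-(∑ j, (ξ j - μ j) ^ 2) / (2 * (ν ^ 2 + σ ^ 2))))
    (α : Fin d → ℝ)
    (hα : ∀ j, α j = ∫ t in (qm j)..(qp j),
        Real.exp (-(t - μt j) ^ 2 / (2 * σt ^ 2)) / (σt * Real.sqrt (2 * Real.pi)))
    (θ : Fin d → ℝ)
    (hθ : ∀ j, θ j = σt / Real.sqrt (2 * Real.pi) *
        (Real.exp (-(qp j - μt j) ^ 2 / (2 * σt ^ 2)) -
          Real.exp (-(qm j - μt j) ^ 2 / (2 * σt ^ 2))))
    (P : Measure (Fin d → ℝ))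
    (hP : P = Measure.pi fun j => gaussianReal (μ j) ⟨σ ^ 2, sq_nonneg σ⟩)
    (j : Fin d) :
    ∫ x, Real.exp (-(∑ i, (x i - ξ i) ^ 2) / (2 * ν ^ 2)) *
        (if qm j ≤ x j ∧ x j < qp j then (1 : ℝ) else 0) * f x ∂P
      = Cd * (α j * f μt - a j * θ j) := by
  obtain ⟨v, hv, hP⟩ : ∃ v : NNReal, (v : ℝ) = σ ^ 2 ∧
      P = Measure.pi fun j => gaussianReal (μ j) v := ⟨_, rfl, hP⟩
  obtain ⟨w, hws⟩ : ∃ w : NNReal, (w : ℝ) = σt ^ 2 := ⟨⟨σt ^ 2, sq_nonneg σt⟩, rfl⟩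
  have hw : (w : ℝ) = ν ^ 2 * σ ^ 2 / (ν ^ 2 + σ ^ 2) := by
    rw [hws, hσt, div_pow, Real.sq_sqrt (by positivity), mul_pow]
  have hs0 : 0 < σt := by rw [hσt]; positivity
  set z : ℝ → ℝ := fun t => if qm j ≤ t ∧ t < qp j then 1 else 0 with hz
  set W : (Fin d → ℝ) → ℝ := fun x => Real.exp (-(∑ i, (x i - ξ i) ^ 2) / (2 * ν ^ 2))
  have hzmeas : Measurable z := by
    refine Measurable.ite ?_ measurable_const measurable_const
    exact measurableSet_Ico
  have hzbound (t : ℝ) : ‖z t‖ ≤ 1 := by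
    simp only [hz]
    split_ifs <;> simp
  -- the feature and the monomial `x i`, as products of one-coordinate functions
  let g₀ : Fin d → ℝ → ℝ := fun k t => if k = j then z t else 1
  let g₁ : Fin d → Fin d → ℝ → ℝ := fun i k t => g₀ k t * if k = i then t else 1
  have hprod₀ (x : Fin d → ℝ) : ∏ k, g₀ k (x k) = z (x j) := by
    simp [g₀]
  have hprod₁ (i : Fin d) (x : Fin d → ℝ) : ∏ k, g₁ i k (x k) = z (x j) * x i := by
    simp only [g₁, Finset.prod_mul_distrib, hprod₀]
    simp
  have hg₀meas (k : Fin d) : Measurable (g₀ k) := by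
    by_cases hk : k = j <;> simp [g₀, hk, hzmeas]
  have hg₀bound (k : Fin d) (t : ℝ) : ‖g₀ k t‖ ≤ 1 := by
    by_cases hk : k = j <;> simp only [g₀, hk, if_true, if_false, hzbound, norm_one, le_refl]
  have hid (m : ℝ) : Integrable (fun t : ℝ => t) (gaussianReal m v) :=
    memLp_one_iff_integrable.1 (memLp_id_gaussianReal 1)
  have hint₀ (k : Fin d) : Integrable (g₀ k) (gaussianReal (μ k) v) :=
    Integrable.of_bound (hg₀meas k).aestronglyMeasurable 1 (.of_forall (hg₀bound k))
  have hint₁ (i k : Fin d) : Integrable (g₁ i k) (gaussianReal (μ k) v) := by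
    refine Integrable.bdd_mul ?_ (hg₀meas k).aestronglyMeasurable (.of_forall (hg₀bound k))
    by_cases hk : k = i
    · simpa [hk] using hid _
    · simp [hk]
  have hzint : ∫ t, z t ∂gaussianReal (μt j) w = α j := by
    simpa [hα j] using integral_Ico_ite_mul_gaussianReal hs0 hws (hq j).le (μt j) fun _ => 1
  have hzid : ∫ t, z t * t ∂gaussianReal (μt j) w =
      α j * μt j - θ j := by
    rw [hα j, hθ j, ← integral_gaussian_mul_id hs0]
    exact integral_Ico_ite_mul_gaussianReal hs0 hws (hq j).le (μt j) fun t => t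
  have hmean₀ (k : Fin d) : ∫ t, g₀ k t ∂gaussianReal (μt k) w =
      if k = j then α j else 1 := by
    by_cases hk : k = j
    · subst hk; simpa [g₀] using hzint
    · simp [g₀, hk]
  have hE (g : Fin d → ℝ → ℝ) : ∫ x, W x * ∏ k, g k (x k) ∂P =
      Cd * ∏ k, ∫ t, g k t ∂gaussianReal (μt k) w := by
    simp only [hP, hCd, hμt]
    exact integral_gaussianKernel_mul_prod_pi_gaussianReal hσ hν hv hw ξ μ g
  have hE₀ : ∫ x, W x * z (x j) ∂P = Cd * α j := by
    simpa only [hprod₀, hmean₀, Finset.prod_ite_eq', Finset.mem_univ, if_true] using hE g₀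
  have hE₁ (i : Fin d) : ∫ x, W x * (z (x j) * x i) ∂P =
      Cd * (α j * μt i - if i = j then θ j else 0) := by
    have h := hE (g₁ i)
    simp only [hprod₁] at h
    rw [h]
    congr 1
    by_cases hij : i = j
    · subst hij
      rw [Finset.prod_eq_single i (fun k _ hk => by simp [g₁, g₀, hk]) (by simp)]
      simpa [g₁, g₀] using hzid
    · have hmean (k : Fin d) : ∫ t, g₁ i k t ∂gaussianReal (μt k) w =
          (if k = j then α j else 1) * if k = i then μt k else 1 := by
        by_cases hk : k = i
        · subst hk
          simp [g₁, g₀, hij]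
        · simpa [g₁, hk] using hmean₀ k
      simp only [hmean, Finset.prod_mul_distrib, Finset.prod_ite_eq', Finset.mem_univ, if_true,
        if_neg hij, sub_zero]
  have hI₀ : Integrable (fun x => W x * z (x j)) P := by
    rw [hP]
    simpa only [hprod₀] using integrable_gaussianKernel_mul_prod_pi ν ξ hint₀
  have hI₁ (i : Fin d) : Integrable (fun x => W x * (z (x j) * x i)) P := by
    rw [hP]
    simpa only [hprod₁] using integrable_gaussianKernel_mul_prod_pi ν ξ (hint₁ i)
  calc ∫ x, W x * z (x j) * f x ∂P
      = ∫ x, ∑ i, a i * (W x * (z (x j) * x i)) + b * (W x * z (x j)) ∂P := by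
        congr 1 with x
        rw [hf, mul_add, Finset.mul_sum]
        congr 1
        · exact Finset.sum_congr rfl fun i _ => by ring
        · ring
    _ = ∑ i, a i * (Cd * (α j * μt i - if i = j then θ j else 0)) + b * (Cd * α j) := by
        rw [integral_add (integrable_finsetSum _ fun i _ => (hI₁ i).const_mul _)
          (hI₀.const_mul _), integral_finsetSum _ fun i _ => (hI₁ i).const_mul _]
        simp only [integral_const_mul, hE₀, hE₁]
    _ = Cd * (α j * f μt - a j * θ j) := by
        have hθsum : ∑ i, a i * (if i = j then θ j else 0) = a j * θ j := by simp
        rw [hf, ← hθsum, mul_add, mul_sub, mul_add, Finset.mul_sum, Finset.mul_sum,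
          Finset.mul_sum, add_sub_right_comm, ← Finset.sum_sub_distrib]
        congr 1
        · exact Finset.sum_congr rfl fun i _ => by ring
        · ring
end

section
/- Let d ≥ 1, let C > 0, and let α_1,…,α_d be real numbers with 0 < α_j < 1 for all j. Let Σ be the (d+1)×(d+1) real matrix with rows and columns indexed by {0,1,…,d}, defined by Σ₀₀ = C, Σ₀ⱼ = Σⱼ₀ = C·α_j for j ≥ 1, Σⱼⱼ = C·α_j for j ≥ 1, and Σⱼₖ = C·α_j·α_k for distinct j,k ≥ 1. Then Σ is invertible, and Σ⁻¹ is the matrix with (Σ⁻¹)₀₀ = C⁻¹·(1 + Σ_{j=1}^d α_j/(1−α_j)), (Σ⁻¹)₀ⱼ = (Σ⁻¹)ⱼ₀ = −C⁻¹/(1−α_j) for j ≥ 1, (Σ⁻¹)ⱼⱼ = C⁻¹/(α_j(1−α_j)) for j ≥ 1, and (Σ⁻¹)ⱼₖ = 0 for distinct j,k ≥ 1. -/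
open Matrix

/-- Closed-form inverse of the LIME population covariance matrix. -/
theorem sigma_inverse (d : ℕ) (hd : 1 ≤ d) (C : ℝ) (hC : 0 < C)
    (α : Fin d → ℝ) (hα : ∀ j, 0 < α j ∧ α j < 1)
    (S Sinv : Matrix (Fin (d + 1)) (Fin (d + 1)) ℝ)
    (hS00 : S 0 0 = C)
    (hS0j : ∀ j : Fin d, S 0 j.succ = C * α j)
    (hSj0 : ∀ j : Fin d, S j.succ 0 = C * α j)
    (hSjj : ∀ j : Fin d, S j.succ j.succ = C * α j)
    (hSjk : ∀ j k : Fin d, j ≠ k → S j.succ k.succ = C * α j * α k)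
    (hI00 : Sinv 0 0 = C⁻¹ * (1 + ∑ j, α j / (1 - α j)))
    (hI0j : ∀ j : Fin d, Sinv 0 j.succ = -C⁻¹ / (1 - α j))
    (hIj0 : ∀ j : Fin d, Sinv j.succ 0 = -C⁻¹ / (1 - α j))
    (hIjj : ∀ j : Fin d, Sinv j.succ j.succ = C⁻¹ / (α j * (1 - α j)))
    (hIjk : ∀ j k : Fin d, j ≠ k → Sinv j.succ k.succ = 0) :
    IsUnit S ∧ S⁻¹ = Sinv := by
  have hα0 : ∀ j, α j ≠ 0 := fun j => (hα j).1.ne'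
  have hα1 : ∀ j, 1 - α j ≠ 0 := fun j => (sub_pos.mpr (hα j).2).ne'
  have hC0 : C ≠ 0 := hC.ne'
  have hcol : ∀ (i : Fin (d + 1)) (k : Fin d),
      ∑ l : Fin d, S i l.succ * Sinv l.succ k.succ =
        S i k.succ * (C⁻¹ / (α k * (1 - α k))) := by
    intro i k
    rw [Finset.sum_eq_single k, hIjj]
    · intro l _ hl
      rw [hIjk l k hl, mul_zero]
    · simp
  have hmul : S * Sinv = 1 := by
    ext i k
    rw [Matrix.mul_apply, Fin.sum_univ_succ]
    refine Fin.cases ?_ (fun k => ?_) k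
    · refine Fin.cases ?_ (fun j => ?_) i
      · have hterm : ∀ l : Fin d, S 0 l.succ * Sinv l.succ 0 = -(α l / (1 - α l)) := by
          intro l
          rw [hS0j, hIj0]
          field_simp
        rw [Finset.sum_congr rfl fun l _ => hterm l, Finset.sum_neg_distrib, hS00, hI00,
          Matrix.one_apply_eq]
        field_simp
        ring
      · have hterm : ∀ l : Fin d, S j.succ l.succ * Sinv l.succ 0 =
            -(α j * (α l / (1 - α l))) - if j = l then α j else 0 := by
          intro l
          have := hα1 l
          rw [hIj0]
          split_ifs with h
          · subst h
            rw [hSjj]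
            field_simp
            ring
          · rw [hSjk j l h]
            field_simp
            ring
        rw [Finset.sum_congr rfl fun l _ => hterm l, Finset.sum_sub_distrib,
          Finset.sum_neg_distrib, ← Finset.mul_sum, Finset.sum_ite_eq, hSj0, hI00,
          Matrix.one_apply_ne (Fin.succ_ne_zero j)]
        simp only [Finset.mem_univ, if_true]
        field_simp
        ring
    · have h0 := hα0 k
      have h1 := hα1 k
      rw [hcol, hI0j]
      refine Fin.cases ?_ (fun j => ?_) i
      · rw [hS00, hS0j, Matrix.one_apply_ne (Fin.succ_ne_zero k).symm]
        field_simp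
        ring
      · rw [hSj0]
        by_cases h : j = k
        · subst h
          rw [hSjj, Matrix.one_apply_eq]
          field_simp
          ring
        · rw [hSjk j k h, Matrix.one_apply_ne fun e => h (Fin.succ_injective _ e)]
          field_simp
          ring
  exact ⟨IsUnit.of_mul_eq_one Sinv hmul, Matrix.inv_eq_right_inv hmul⟩
end

section
/- Let d ≥ 1, C > 0, α_1,…,α_d ∈ (0,1), and let Σ be the (d+1)×(d+1) matrix with Σ₀₀ = C, Σ₀ⱼ = Σⱼ₀ = C·α_j, Σⱼⱼ = C·α_j, and Σⱼₖ = C·α_j·α_k for distinct j,k ≥ 1. Then the ℓ²→ℓ² operator norm of Σ⁻¹ satisfies ‖Σ⁻¹‖_op ≤ 3·d·A/C, where A = max_{1≤j≤d} 1/(α_j(1−α_j)). -/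
open Matrix

/-- The ℓ²→ℓ² operator norm (spectral norm) of a square real matrix. -/
noncomputable def matOpNorm {m : ℕ} (M : Matrix (Fin m) (Fin m) ℝ) : ℝ :=
  ‖Matrix.toEuclideanCLM (𝕜 := ℝ) M‖

/-- A coercive matrix with constant `l` has an inverse of operator norm at most `1 / l`. -/
theorem matOpNorm_inv_le_of_coercive {m : ℕ} (S : Matrix (Fin m) (Fin m) ℝ) {l : ℝ} (hl : 0 < l)
    (hS : ∀ v : Fin m → ℝ, l * (v ⬝ᵥ v) ≤ v ⬝ᵥ (S *ᵥ v)) : matOpNorm S⁻¹ ≤ 1 / l := by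
  unfold matOpNorm
  by_cases hdet : IsUnit S.det
  · refine ContinuousLinearMap.opNorm_le_bound _ (by positivity) fun y => ?_
    set x := Matrix.toEuclideanCLM (𝕜 := ℝ) S⁻¹ y with hx
    have hSx : S *ᵥ x.ofLp = y.ofLp := by
      rw [hx, Matrix.ofLp_toEuclideanCLM, Matrix.mulVec_mulVec, Matrix.mul_nonsing_inv _ hdet,
        Matrix.one_mulVec]
    have hcoer := hS x.ofLp
    rw [hSx] at hcoer
    have hnorm : x.ofLp ⬝ᵥ x.ofLp = ‖x‖ ^ 2 := by
      rw [EuclideanSpace.real_norm_sq_eq]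
      simp [dotProduct, sq]
    have hinner : x.ofLp ⬝ᵥ y.ofLp ≤ ‖x‖ * ‖y‖ := by
      refine le_trans (le_of_eq ?_) (real_inner_le_norm x y)
      simp [PiLp.inner_apply, dotProduct, mul_comm]
    rw [hnorm] at hcoer
    rw [one_div, inv_mul_eq_div, le_div_iff₀ hl]
    rcases (norm_nonneg x).eq_or_lt with h0 | hpos
    · rw [← h0]
      simp
    · refine le_of_mul_le_mul_left ?_ hpos
      linarith
  · rw [Matrix.nonsing_inv_apply_not_isUnit _ hdet, map_zero, norm_zero]
    positivity

/-- The lower bound on the quadratic form obtained by completing the square in the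
zeroth coordinate. -/
theorem sum_sq_le_three_mul_quadratic {d : ℕ} (hd : 1 ≤ d) {α : Fin d → ℝ}
    (hα : ∀ j, 0 < α j ∧ α j < 1) {A : ℝ} (hA : ∀ j, 1 / (α j * (1 - α j)) ≤ A)
    (x₀ : ℝ) (x : Fin d → ℝ) :
    x₀ ^ 2 + ∑ j, x j ^ 2 ≤
      3 * d * A * ((x₀ + ∑ j, α j * x j) ^ 2 + ∑ j, α j * (1 - α j) * x j ^ 2) := by
  have hd' : (1 : ℝ) ≤ d := by exact_mod_cast hd
  have hvar : ∀ j, 0 < α j * (1 - α j) := fun j => mul_pos (hα j).1 (by linarith [(hα j).2])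
  have hone : ∀ j, 1 ≤ A * (α j * (1 - α j)) := fun j => (div_le_iff₀ (hvar j)).1 (hA j)
  have hA1 : 1 ≤ A := by
    have j : Fin d := ⟨0, hd⟩
    refine le_trans ?_ (hA j)
    rw [le_div_iff₀ (hvar j)]
    nlinarith [sq_nonneg (α j), (hα j).2]
  have hdiag : ∑ j, x j ^ 2 ≤ A * ∑ j, α j * (1 - α j) * x j ^ 2 := by
    rw [Finset.mul_sum]
    refine Finset.sum_le_sum fun j _ => ?_
    nlinarith [hone j, sq_nonneg (x j)]
  have hcross : (∑ j, α j * x j) ^ 2 ≤ d * ∑ j, x j ^ 2 := by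
    refine (sq_sum_le_card_mul_sum_sq).trans ?_
    rw [Finset.card_univ, Fintype.card_fin]
    refine mul_le_mul_of_nonneg_left (Finset.sum_le_sum fun j _ => ?_) (by positivity)
    rw [mul_pow]
    refine mul_le_of_le_one_left (sq_nonneg _) ?_
    nlinarith [(hα j).1, (hα j).2]
  have hT : 0 ≤ ∑ j, x j ^ 2 := Finset.sum_nonneg fun j _ => sq_nonneg _
  generalize ∑ j, α j * x j = t at *
  generalize ∑ j, α j * (1 - α j) * x j ^ 2 = q at *
  generalize ∑ j, x j ^ 2 = T at *
  have hdA : 1 ≤ d * A := by nlinarith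
  have hsq : x₀ ^ 2 ≤ 2 * (x₀ + t) ^ 2 + 2 * t ^ 2 := by nlinarith [sq_nonneg (x₀ + 2 * t)]
  have hu : (x₀ + t) ^ 2 ≤ d * A * (x₀ + t) ^ 2 := le_mul_of_one_le_left (sq_nonneg _) hdA
  have hq : d * T ≤ d * (A * q) := mul_le_mul_of_nonneg_left hdiag (by positivity)
  have hTd : T ≤ d * T := le_mul_of_one_le_left hT hd'
  nlinarith [sq_nonneg (x₀ + t)]

/-- Control of the operator norm of the inverse covariance matrix:
`‖Σ⁻¹‖_op ≤ 3 d A / C` where `A = max_j 1/(α_j (1−α_j))`. -/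
theorem opNorm_sigma_inverse_le (d : ℕ) (hd : 1 ≤ d) (C : ℝ) (hC : 0 < C)
    (α : Fin d → ℝ) (hα : ∀ j, 0 < α j ∧ α j < 1)
    (S : Matrix (Fin (d + 1)) (Fin (d + 1)) ℝ)
    (hS00 : S 0 0 = C)
    (hS0j : ∀ j : Fin d, S 0 j.succ = C * α j)
    (hSj0 : ∀ j : Fin d, S j.succ 0 = C * α j)
    (hSjj : ∀ j : Fin d, S j.succ j.succ = C * α j)
    (hSjk : ∀ j k : Fin d, j ≠ k → S j.succ k.succ = C * α j * α k)
    (A : ℝ)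
    (hA : IsGreatest (Set.range fun j : Fin d => 1 / (α j * (1 - α j))) A) :
    matOpNorm S⁻¹ ≤ 3 * d * A / C := by
  have hd' : (0 : ℝ) < d := by exact_mod_cast hd
  have hA0 : 0 < A := by
    obtain ⟨j, rfl⟩ := hA.1
    exact one_div_pos.2 (mul_pos (hα j).1 (by linarith [(hα j).2]))
  have hS : S = C • (vecMulVec (Fin.cons 1 α : Fin (d + 1) → ℝ) (Fin.cons 1 α)
      + diagonal (Fin.cons 0 fun j => α j * (1 - α j))) := by
    ext i k
    refine Fin.cases ?_ (fun i => ?_) i <;> refine Fin.cases ?_ (fun k => ?_) k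
    · simp [hS00, vecMulVec_apply]
    · simp [hS0j, vecMulVec_apply, (Fin.succ_ne_zero k).symm]
    · simp [hSj0, vecMulVec_apply]
    · by_cases h : i = k
      · subst h
        simp only [hSjj, Matrix.smul_apply, Matrix.add_apply, vecMulVec_apply, diagonal_apply_eq,
          Fin.cons_succ, smul_eq_mul]
        ring
      · simp [hSjk i k h, vecMulVec_apply, h]
        ring
  rw [← one_div_div]
  refine matOpNorm_inv_le_of_coercive S (by positivity) fun v => ?_
  have hquad : v ⬝ᵥ (S *ᵥ v) = C * ((v 0 + ∑ j : Fin d, α j * v j.succ) ^ 2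
      + ∑ j : Fin d, α j * (1 - α j) * v j.succ ^ 2) := by
    have hdiag : v ⬝ᵥ (diagonal (Fin.cons 0 fun j => α j * (1 - α j)) *ᵥ v)
        = ∑ j : Fin d, α j * (1 - α j) * v j.succ ^ 2 := by
      simp only [dotProduct, mulVec_diagonal, Fin.sum_univ_succ, Fin.cons_zero, Fin.cons_succ,
        zero_mul, mul_zero, zero_add]
      exact Finset.sum_congr rfl fun j _ => by ring
    have hdot : (Fin.cons 1 α : Fin (d + 1) → ℝ) ⬝ᵥ v = v 0 + ∑ j : Fin d, α j * v j.succ := by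
      simp [dotProduct, Fin.sum_univ_succ]
    rw [hS, smul_mulVec, dotProduct_smul, add_mulVec, dotProduct_add, hdiag, vecMulVec_mulVec,
      dotProduct_smul, dotProduct_comm v, hdot]
    simp only [MulOpposite.smul_eq_mul_unop, MulOpposite.unop_op, smul_eq_mul, sq]
  have hbound := sum_sq_le_three_mul_quadratic hd hα (fun j => hA.2 ⟨j, rfl⟩) (v 0)
    fun j => v j.succ
  have hnorm : v ⬝ᵥ v = v 0 ^ 2 + ∑ j : Fin d, v j.succ ^ 2 := by
    simp [dotProduct, Fin.sum_univ_succ, sq]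
  rw [hquad, hnorm, div_mul_eq_mul_div, div_le_iff₀ (by positivity)]
  calc _ ≤ C * _ := mul_le_mul_of_nonneg_left hbound hC.le
    _ = _ := by ring
end

section
/- Let d ≥ 1, C > 0, α_1,…,α_d ∈ (0,1), a ∈ ℝ^d, and let v, θ_1,…,θ_d be real numbers. Let Σ be the (d+1)×(d+1) matrix with Σ₀₀ = C, Σ₀ⱼ = Σⱼ₀ = C·α_j, Σⱼⱼ = C·α_j, Σⱼₖ = C·α_j·α_k for distinct j,k ≥ 1, and let Γ ∈ ℝ^{d+1} be the vector with Γ₀ = C·v and Γⱼ = C·(α_j·v − a_j·θ_j) for j ≥ 1. Then β := Σ⁻¹·Γ satisfies β₀ = v + Σ_{j=1}^d a_j·θ_j/(1−α_j) and βⱼ = −a_j·θ_j/(α_j(1−α_j)) for j ≥ 1. -/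
open Matrix

/-- The unique candidate solution of `S *ᵥ x = y`, for `S` the second-moment matrix (scaled by `C`)
of the constant `1` and independent Bernoulli variables with means `α j`. -/
theorem eq_of_bernoulliMoment_mulVec_eq {d : ℕ} {C : ℝ} (hC : C ≠ 0) {α : Fin d → ℝ}
    (hα : ∀ j, 0 < α j ∧ α j < 1) {S : Matrix (Fin (d + 1)) (Fin (d + 1)) ℝ}
    (hS00 : S 0 0 = C)
    (hS0j : ∀ j : Fin d, S 0 j.succ = C * α j)
    (hSj0 : ∀ j : Fin d, S j.succ 0 = C * α j)
    (hSjj : ∀ j : Fin d, S j.succ j.succ = C * α j)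
    (hSjk : ∀ j k : Fin d, j ≠ k → S j.succ k.succ = C * α j * α k)
    {x y : Fin (d + 1) → ℝ} (h : S *ᵥ x = y) :
    x 0 = y 0 / C - ∑ j, (y j.succ - α j * y 0) / (C * (1 - α j)) ∧
      ∀ j : Fin d, x j.succ = (y j.succ - α j * y 0) / (C * α j * (1 - α j)) := by
  have h0 : C * x 0 + ∑ k, C * α k * x k.succ = y 0 := by
    simp [← h, mulVec, dotProduct, Fin.sum_univ_succ, hS00, hS0j]
  have hrow (j k : Fin d) : S j.succ k.succ * x k.succ =
      α j * (C * α k * x k.succ) + if k = j then C * α j * (1 - α j) * x j.succ else 0 := by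
    split_ifs with hkj
    · subst hkj
      rw [hSjj]
      ring
    · rw [hSjk j k (Ne.symm hkj)]
      ring
  have hsucc (j : Fin d) : α j * y 0 + C * α j * (1 - α j) * x j.succ = y j.succ := by
    have hj : S j.succ 0 * x 0 + ∑ k : Fin d, S j.succ k.succ * x k.succ = y j.succ := by
      simp [← h, mulVec, dotProduct, Fin.sum_univ_succ]
    simp only [hrow, hSj0, Finset.sum_add_distrib, ← Finset.mul_sum, Finset.sum_ite_eq',
      Finset.mem_univ, if_true] at hj
    rw [← hj, ← h0]
    ring
  have hx (j : Fin d) : x j.succ = (y j.succ - α j * y 0) / (C * α j * (1 - α j)) := by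
    have h1 := (hα j).1.ne'
    have h2 : 1 - α j ≠ 0 := (sub_pos.2 (hα j).2).ne'
    rw [eq_div_iff (by positivity), ← hsucc j]
    ring
  refine ⟨?_, hx⟩
  have hsum : ∑ k, C * α k * x k.succ = C * ∑ k, (y k.succ - α k * y 0) / (C * (1 - α k)) := by
    rw [Finset.mul_sum]
    refine Finset.sum_congr rfl fun k _ => ?_
    have h1 := (hα k).1.ne'
    have h2 : 1 - α k ≠ 0 := (sub_pos.2 (hα k).2).ne'
    rw [hx k]
    field_simp
  rw [hsum, ← mul_add] at h0
  rw [eq_sub_iff_add_eq, eq_div_iff hC, mul_comm, h0]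

/-- Closed form for `β = Σ⁻¹ Γ` in the LIME setting. -/
theorem beta_closed_form (d : ℕ) (hd : 1 ≤ d) (C : ℝ) (hC : 0 < C)
    (α : Fin d → ℝ) (hα : ∀ j, 0 < α j ∧ α j < 1)
    (a θ : Fin d → ℝ) (v : ℝ)
    (S : Matrix (Fin (d + 1)) (Fin (d + 1)) ℝ)
    (hS00 : S 0 0 = C)
    (hS0j : ∀ j : Fin d, S 0 j.succ = C * α j)
    (hSj0 : ∀ j : Fin d, S j.succ 0 = C * α j)
    (hSjj : ∀ j : Fin d, S j.succ j.succ = C * α j)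
    (hSjk : ∀ j k : Fin d, j ≠ k → S j.succ k.succ = C * α j * α k)
    (Γ : Fin (d + 1) → ℝ)
    (hΓ0 : Γ 0 = C * v)
    (hΓj : ∀ j : Fin d, Γ j.succ = C * (α j * v - a j * θ j)) :
    (S⁻¹.mulVec Γ) 0 = v + ∑ j, a j * θ j / (1 - α j) ∧
      ∀ j : Fin d, (S⁻¹.mulVec Γ) j.succ = -(a j * θ j) / (α j * (1 - α j)) := by
  have solve {x y : Fin (d + 1) → ℝ} (h : S *ᵥ x = y) :=
    eq_of_bernoulliMoment_mulVec_eq hC.ne' hα hS00 hS0j hSj0 hSjj hSjk h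
  have hunit : IsUnit S := by
    refine mulVec_injective_iff_isUnit.1 fun x z hxz => ?_
    obtain ⟨hx0, hx⟩ := solve hxz
    obtain ⟨hz0, hz⟩ := solve (rfl : S *ᵥ z = S *ᵥ z)
    funext i
    refine Fin.cases (hx0.trans hz0.symm) (fun j => (hx j).trans (hz j).symm) i
  have hβ : S *ᵥ (S⁻¹ *ᵥ Γ) = Γ := by
    rw [mulVec_mulVec, mul_nonsing_inv _ ((isUnit_iff_isUnit_det S).1 hunit), one_mulVec]
  obtain ⟨h0, hsucc⟩ := solve hβ
  constructor
  · rw [h0, hΓ0, mul_div_cancel_left₀ _ hC.ne', sub_eq_add_neg, ← Finset.sum_neg_distrib]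
    congr 1
    refine Finset.sum_congr rfl fun j _ => ?_
    have h2 : 1 - α j ≠ 0 := (sub_pos.2 (hα j).2).ne'
    rw [hΓj]
    field_simp
    ring
  · intro j
    have h1 := (hα j).1.ne'
    have h2 : 1 - α j ≠ 0 := (sub_pos.2 (hα j).2).ne'
    rw [hsucc, hΓ0, hΓj]
    field_simp
    ring
end
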